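/- Let T_0 = π/(2m) with m ∈ ℕ, m ≥ 1. Then T_opt(T_0) = 2π; in particular the set { t > 0 : μ((D(T_0,t))ᶜ) = 0 } is nonempty. -/

import Mathlib

open MeasureTheory Set Real Filter Topology

noncomputable section

instance : Fact (0 < 2 * Real.pi) := ⟨by positivity⟩

/-- λ_k: 0 for even k, π for odd k. -/
def lam (k : ℕ) : ℝ := if Even k then 0 else Real.pi

/-- Covered set D(T₀, t) ⊆ ℝ/(2πℤ): the union over k of the projections of the
observation intervals (k·T₀, min((k+1)·T₀, t)) translated by −λ_k. -/
def coveredSet (T0 t : ℝ) : Set (AddCircle (2 * Real.pi)) :=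
  ⋃ k : ℕ, (fun a : ℝ => ((a - lam k : ℝ) : AddCircle (2 * Real.pi))) ''
    Set.Ioo ((k : ℝ) * T0) (min (((k : ℝ) + 1) * T0) t)

/-- Optimal control time T_opt(T₀). -/
def Topt (T0 : ℝ) : ℝ :=
  sInf { t : ℝ | 0 < t ∧ volume (coveredSet T0 t)ᶜ = 0 }

theorem coe_eq_iff_aux (a b : ℝ) :
    ((a : ℝ) : AddCircle (2 * Real.pi)) = (b : ℝ) ↔ ∃ n : ℤ, a - b = n * (2 * Real.pi) := by
  rw [← sub_eq_zero, ← AddCircle.coe_sub, AddCircle.coe_eq_zero_iff]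
  constructor
  · rintro ⟨n, hn⟩
    exact ⟨n, by rw [← hn]; simp⟩
  · rintro ⟨n, hn⟩
    exact ⟨n, by rw [hn]; simp⟩

theorem upper_aux (m : ℕ) (hm : 1 ≤ m) (T0 : ℝ) (h0 : 0 < T0) (hpi : Real.pi = 2 * m * T0) :
    volume (coveredSet T0 (2 * Real.pi))ᶜ = 0 := by
  have hc : (Set.range (fun j : ℤ => ((j * T0 : ℝ) : AddCircle (2 * Real.pi)))).Countable :=
    Set.countable_range _
  have : NullSingletonClass (volume : Measure (AddCircle (2 * Real.pi))) := by
    constructor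
    intro x
    obtain ⟨y, rfl⟩ := QuotientAddGroup.mk_surjective x
    have := AddCircle.volume_closedBall (2 * Real.pi) (x := (y : AddCircle (2 * Real.pi))) 0
    rw [Metric.closedBall_zero] at this
    refine this.trans ?_
    simp [Real.pi_pos.le]
  refine measure_mono_null ?_ (hc.measure_zero volume)
  intro y hy
  by_contra hny
  apply hy
  obtain ⟨x, hx, rfl⟩ : ∃ x ∈ Set.Ico (0:ℝ) (0 + 2 * Real.pi), ((x : ℝ) : AddCircle (2 * Real.pi)) = y := by
    have := AddCircle.coe_image_Ico_eq (2 * Real.pi) 0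
    have h2 : y ∈ (Set.univ : Set (AddCircle (2 * Real.pi))) := trivial
    rw [← this] at h2
    exact h2
  obtain ⟨hx0, hx1⟩ := hx
  rw [zero_add] at hx1
  set j := ⌊x / T0⌋₊ with hj
  have hj1 : (j : ℝ) * T0 ≤ x := by
    have := Nat.floor_le (div_nonneg hx0 h0.le)
    rwa [le_div_iff₀ h0] at this
  have hj2 : x < ((j : ℝ) + 1) * T0 := by
    have := Nat.lt_floor_add_one (x / T0)
    rwa [div_lt_iff₀ h0] at this
  have hj1' : (j : ℝ) * T0 < x := by
    refine lt_of_le_of_ne hj1 fun h => hny ⟨(j : ℤ), ?_⟩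
    simp only [Int.cast_natCast, h]
  clear_value j
  have hjm : j < 4 * m := by
    have : (j : ℝ) * T0 < (4 * m : ℝ) * T0 := by linarith
    have := lt_of_mul_lt_mul_right this h0.le
    exact_mod_cast this
  have hjm' : (j : ℝ) + 1 ≤ 4 * m := by exact_mod_cast hjm
  have hjm3 : ((j : ℝ) + 1) * T0 ≤ 4 * m * T0 := mul_le_mul_of_nonneg_right hjm' h0.le
  unfold coveredSet
  rw [Set.mem_iUnion]
  by_cases hev : Even j
  · refine ⟨j, x, ⟨hj1', lt_min hj2 hx1⟩, ?_⟩
    simp [lam, hev]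
  · by_cases hlt : j < 2 * m
    · have hlt' : (j : ℝ) + 1 ≤ 2 * m := by exact_mod_cast hlt
      have h4 : ((j : ℝ) + 1) * T0 ≤ 2 * m * T0 := mul_le_mul_of_nonneg_right hlt' h0.le
      have hne : ¬ Even (j + 2 * m) := by
        rw [Nat.even_add]; simp [hev]
      refine ⟨j + 2 * m, x + Real.pi, ⟨?_, lt_min ?_ ?_⟩, ?_⟩
      · push_cast; nlinarith
      · push_cast; nlinarith
      · linarith
      · simp [lam, hne]
    · obtain ⟨k, rfl⟩ := Nat.exists_eq_add_of_le (not_lt.mp hlt)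
      have hne : ¬ Even k := by
        intro h; apply hev; rw [Nat.even_add]; simp [h]
      push_cast at *
      refine ⟨k, x - Real.pi, ⟨by nlinarith, lt_min (by nlinarith) (by linarith [Real.pi_pos])⟩, ?_⟩
      simp only [lam, hne, if_false]
      rw [coe_eq_iff_aux]
      exact ⟨-1, by push_cast; ring⟩

theorem lower_aux (m : ℕ) (hm : 1 ≤ m) (T0 : ℝ) (h0 : 0 < T0) (hpi : Real.pi = 2 * m * T0)
    (t : ℝ) (h : volume (coveredSet T0 t)ᶜ = 0) : 2 * Real.pi ≤ t := by
  by_contra! hlt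
  set U : Set (AddCircle (2 * Real.pi)) :=
    (fun a : ℝ => (a : AddCircle (2 * Real.pi))) ''
      Set.Ioo (max t (2 * Real.pi - T0) - Real.pi) Real.pi with hU
  have hUo : IsOpen U := QuotientAddGroup.isOpenMap_coe _ isOpen_Ioo
  have hUn : U.Nonempty := by
    refine (Set.nonempty_Ioo.mpr ?_).image _
    have := max_lt hlt (show 2 * Real.pi - T0 < 2 * Real.pi by linarith)
    linarith
  have hpos := hUo.measure_pos volume hUn
  refine hpos.ne' (measure_mono_null ?_ h)
  rintro _ ⟨x, ⟨hx1, hx2⟩, rfl⟩ hmem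
  have ht := le_max_left t (2 * Real.pi - T0)
  have ht' := le_max_right t (2 * Real.pi - T0)
  unfold coveredSet at hmem
  rw [Set.mem_iUnion] at hmem
  obtain ⟨k, a, ⟨ha1, ha2⟩, hk⟩ := hmem
  obtain ⟨ha2, ha3⟩ := lt_min_iff.mp ha2
  simp only at hk
  rw [coe_eq_iff_aux] at hk
  obtain ⟨n, hn⟩ := hk
  have hkT : 0 ≤ (k : ℝ) * T0 := by positivity
  have hpp := Real.pi_pos
  have hm1 : (1 : ℝ) ≤ m := by exact_mod_cast hm
  have hTpi : 2 * T0 ≤ Real.pi := by nlinarith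
  by_cases hev : Even k
  · simp only [lam, hev, if_true, sub_zero] at hn
    have h1 : (-1 : ℝ) < n := by
      by_contra! hc
      nlinarith
    have h2 : (n : ℝ) < 1 := by
      by_contra! hc
      nlinarith
    have h1' : -1 < n := by exact_mod_cast h1
    have h2' : n < 1 := by exact_mod_cast h2
    obtain rfl : n = 0 := by omega
    have hax : a = x := by simpa [sub_eq_zero] using hn
    subst hax
    have h5 : (k : ℝ) < 2 * m := by
      refine lt_of_mul_lt_mul_right ?_ h0.le
      linarith
    have h6 : (2 * m : ℝ) < k + 2 := by
      refine lt_of_mul_lt_mul_right (a := T0) ?_ h0.le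
      linarith
    have h5' : k < 2 * m := by exact_mod_cast h5
    have h6' : 2 * m < k + 2 := by exact_mod_cast h6
    obtain ⟨r, rfl⟩ := hev
    omega
  · simp only [lam, hev, if_false] at hn
    have h1 : (-1 : ℝ) < n := by
      by_contra! hc
      nlinarith
    have h2 : (n : ℝ) < 0 := by
      by_contra! hc
      nlinarith
    have h1' : -1 < n := by exact_mod_cast h1
    have h2' : n < 0 := by exact_mod_cast h2
    omega

/-- Lemma 1.7 i): if T₀ = π/(2m) then the system is observable and T_opt = 2π. -/
theorem stmt_8 (m : ℕ) (hm : 1 ≤ m) (T0 : ℝ) (hT0 : T0 = Real.pi / (2 * m)) :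
    { t : ℝ | 0 < t ∧ volume (coveredSet T0 t)ᶜ = 0 }.Nonempty ∧
      Topt T0 = 2 * Real.pi := by
  have hm1 : (0 : ℝ) < m := by exact_mod_cast hm
  have h0 : 0 < T0 := by rw [hT0]; positivity
  have hpi : Real.pi = 2 * m * T0 := by rw [hT0]; field_simp
  have hl : IsLeast { t : ℝ | 0 < t ∧ volume (coveredSet T0 t)ᶜ = 0 } (2 * Real.pi) :=
    ⟨⟨by positivity, upper_aux m hm T0 h0 hpi⟩, fun t ht => lower_aux m hm T0 h0 hpi t ht.2⟩
  exact ⟨hl.nonempty, hl.csInf_eq⟩
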